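/- Let E be an arbitrary directed graph and K a field, and let L = L_K(E) be the Leavitt path algebra. Then the following are equivalent: (a) E is acyclic (E contains no cycles); (b) L is von Neumann regular, i.e., for every a ∈ L there exists b ∈ L with a = aba; (c) L is π-regular, i.e., for every a ∈ L there exist b ∈ L and an integer n ≥ 1 with aⁿ = aⁿbaⁿ; (d) L is strongly left π-regular (for every a ∈ L there exist b ∈ L and n ≥ 1 with aⁿ = baⁿ⁺¹), equivalently strongly right π-regular (for every a ∈ L there exist b ∈ L and n ≥ 1 with aⁿ = aⁿ⁺¹b). -/

import Mathlib

/-- Generators for the Leavitt path algebra of a directed graph: one generator for each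
vertex `v`, each edge `e`, and each ghost edge `e*`. -/
inductive LPAGen (V E : Type) : Type
  | vertex : V → LPAGen V E
  | edge : E → LPAGen V E
  | ghost : E → LPAGen V E

/-- The defining relations of the Leavitt path algebra of an arbitrary directed graph
`(V, E, s, r)`, imposed on the free unital `K`-algebra on the generators. -/
inductive LPARel (K : Type) [Field K] (V E : Type) (s r : E → V) :
    FreeAlgebra K (LPAGen V E) → FreeAlgebra K (LPAGen V E) → Prop
  | vertex_orth (v w : V) (h : v ≠ w) :
      LPARel K V E s r (FreeAlgebra.ι K (LPAGen.vertex v) * FreeAlgebra.ι K (LPAGen.vertex w)) 0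
  | vertex_idem (v : V) :
      LPARel K V E s r (FreeAlgebra.ι K (LPAGen.vertex v) * FreeAlgebra.ι K (LPAGen.vertex v))
        (FreeAlgebra.ι K (LPAGen.vertex v))
  | edge_src (e : E) :
      LPARel K V E s r (FreeAlgebra.ι K (LPAGen.vertex (s e)) * FreeAlgebra.ι K (LPAGen.edge e))
        (FreeAlgebra.ι K (LPAGen.edge e))
  | edge_rng (e : E) :
      LPARel K V E s r (FreeAlgebra.ι K (LPAGen.edge e) * FreeAlgebra.ι K (LPAGen.vertex (r e)))
        (FreeAlgebra.ι K (LPAGen.edge e))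
  | ghost_rng (e : E) :
      LPARel K V E s r (FreeAlgebra.ι K (LPAGen.vertex (r e)) * FreeAlgebra.ι K (LPAGen.ghost e))
        (FreeAlgebra.ι K (LPAGen.ghost e))
  | ghost_src (e : E) :
      LPARel K V E s r (FreeAlgebra.ι K (LPAGen.ghost e) * FreeAlgebra.ι K (LPAGen.vertex (s e)))
        (FreeAlgebra.ι K (LPAGen.ghost e))
  | ck1_distinct (e f : E) (h : e ≠ f) :
      LPARel K V E s r (FreeAlgebra.ι K (LPAGen.ghost e) * FreeAlgebra.ι K (LPAGen.edge f)) 0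
  | ck1_same (e : E) :
      LPARel K V E s r (FreeAlgebra.ι K (LPAGen.ghost e) * FreeAlgebra.ι K (LPAGen.edge e))
        (FreeAlgebra.ι K (LPAGen.vertex (r e)))
  | ck2 (v : V) (h : {e : E | s e = v}.Finite) (hne : {e : E | s e = v}.Nonempty) :
      LPARel K V E s r (FreeAlgebra.ι K (LPAGen.vertex v))
        (∑ e ∈ h.toFinset, FreeAlgebra.ι K (LPAGen.edge e) * FreeAlgebra.ι K (LPAGen.ghost e))

/-- The quotient of the free unital `K`-algebra on the generators by the defining
relations of the Leavitt path algebra. -/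
abbrev LPAAmbient (K : Type) [Field K] (V E : Type) (s r : E → V) :=
  RingQuot (LPARel K V E s r)

/-- The image in the ambient quotient algebra of a generator. -/
def lpaGen (K : Type) [Field K] {V E : Type} (s r : E → V) (g : LPAGen V E) :
    LPAAmbient K V E s r :=
  RingQuot.mkRingHom (LPARel K V E s r) (FreeAlgebra.ι K g)

/-- The Leavitt path algebra `L_K(E)` of an arbitrary directed graph: the non-unital
`K`-subalgebra of the ambient quotient algebra generated by the images of the
generators. -/
def LeavittPathAlgebraNU (K : Type) [Field K] (V E : Type) (s r : E → V) :
    NonUnitalSubalgebra K (LPAAmbient K V E s r) :=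
  NonUnitalAlgebra.adjoin K (Set.range (lpaGen K s r))

/-- `pow₁ a n` is the `(n+1)`-st power `a^(n+1)` of an element of a (possibly non-unital)
multiplicative structure; as `n` ranges over `ℕ`, it ranges over all powers `a^m`, `m ≥ 1`. -/
def pow₁ {α : Type*} [Mul α] (a : α) : ℕ → α
  | 0 => a
  | n + 1 => pow₁ a n * a
/-- A list of edges is a path chain if the range of each edge is the source of the next. -/
def IsPathChain {V E : Type} (s r : E → V) (es : List E) : Prop :=
  ∀ (i : ℕ) (h : i + 1 < es.length), r (es[i]'(by omega)) = s (es[i+1]'h)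

/-- A nonempty list of edges is a cycle if it is a closed path chain whose sources are
pairwise distinct. -/
def IsCycle {V E : Type} (s r : E → V) (es : List E) : Prop :=
  ∃ hne : es ≠ [], IsPathChain s r es ∧ r (es.getLast hne) = s (es.head hne) ∧
    (es.map s).Nodup

/-- A path (given as a list of edges) has an exit if some edge `f` has the same source as
one of the edges of the path but differs from it. -/
def HasExit {V E : Type} (s r : E → V) (es : List E) : Prop :=
  ∃ (f : E) (i : ℕ) (h : i < es.length), s f = s (es[i]'h) ∧ f ≠ es[i]'h



set_option linter.unusedSimpArgs false

namespace LPA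

/-! ### Combinatorics of paths -/

/-- Source of a path with end vertex `w`. -/
def src {V E : Type} (s : E → V) (w : V) : List E → V
  | [] => w
  | e :: _ => s e

/-- `l` is a path ending in `w`. -/
def Pth {V E : Type} (s r : E → V) (w : V) : List E → Prop
  | [] => True
  | e :: l => r e = src s w l ∧ Pth s r w l

/-- One step along an edge. -/
def Step {V E : Type} (s r : E → V) (v w : V) : Prop := ∃ e, s e = v ∧ r e = w

section comb
variable {V E : Type} {s r : E → V}

lemma Pth.append_left {w : V} {l₁ : List E} {f : E} {l₂ : List E}
    (h : Pth s r w (l₁ ++ f :: l₂)) :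
    Pth s r (s f) l₁ ∧ src s w (l₁ ++ f :: l₂) = src s (s f) l₁ := by
  induction l₁ with
  | nil => exact ⟨trivial, rfl⟩
  | cons e t ih =>
    obtain ⟨h1, h2⟩ := h
    have := ih h2
    exact ⟨⟨h1.trans this.2, this.1⟩, rfl⟩

lemma exists_short {w : V} {l : List E} (h : Pth s r w l) (hn : ¬ (l.map s).Nodup) :
    ∃ v l', l' ≠ [] ∧ Pth s r v l' ∧ src s v l' = v ∧ l'.length < l.length := by
  induction l with
  | nil => simp at hn
  | cons e t ih =>
    by_cases ht : (t.map s).Nodup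
    · have : s e ∈ t.map s := by
        by_contra hc
        exact hn (by rw [List.map_cons, List.nodup_cons]; exact ⟨hc, ht⟩)
      obtain ⟨f, hf, hfe⟩ := List.mem_map.1 this
      obtain ⟨t1, t2, rfl⟩ := List.append_of_mem hf
      have := Pth.append_left (l₁ := e :: t1) h
      refine ⟨s f, e :: t1, by simp, this.1, ?_, by simp⟩
      exact hfe.symm
    · obtain ⟨v, l', h1, h2, h3, h4⟩ := ih h.2 ht
      exact ⟨v, l', h1, h2, h3, by simp; omega⟩

lemma Pth.chain {w : V} {l : List E} (h : Pth s r w l) : IsPathChain s r l := by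
  induction l with
  | nil => intro i hi; simp at hi
  | cons e t ih =>
    intro i hi
    cases i with
    | zero =>
      cases t with
      | nil => simp at hi
      | cons f t => simpa [src] using h.1
    | succ i => simpa using ih h.2 i (by simpa using hi)

lemma Pth.last {w : V} {l : List E} (h : Pth s r w l) (hne : l ≠ []) :
    r (l.getLast hne) = w := by
  induction l with
  | nil => exact absurd rfl hne
  | cons e t ih =>
    cases t with
    | nil => exact h.1
    | cons f t => rw [List.getLast_cons (by simp)]; exact ih h.2 _

lemma src_head {w : V} {l : List E} (hne : l ≠ []) : src s w l = s (l.head hne) := by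
  cases l with
  | nil => exact absurd rfl hne
  | cons e t => rfl

lemma pth_of_chain {l : List E} (hne : l ≠ []) (h : IsPathChain s r l) :
    Pth s r (r (l.getLast hne)) l := by
  induction l with
  | nil => exact absurd rfl hne
  | cons e t ih =>
    cases t with
    | nil => exact ⟨rfl, trivial⟩
    | cons f t =>
      rw [List.getLast_cons (by simp)]
      refine ⟨by simpa [src] using h 0 (by simp), ih _ ?_⟩
      intro i hi
      exact h (i + 1) (by simpa using hi)

lemma exists_cycle_of_closed {v : V} {l : List E} (hne : l ≠ []) (h : Pth s r v l)
    (hc : src s v l = v) : ∃ es, IsCycle s r es := by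
  induction hn : l.length using Nat.strong_induction_on generalizing v l with
  | _ n ih =>
    by_cases hd : (l.map s).Nodup
    · exact ⟨l, hne, h.chain, by rw [h.last hne, ← src_head (s := s) (w := v) hne, hc], hd⟩
    · obtain ⟨v', l', h1, h2, h3, h4⟩ := exists_short h hd
      exact ih _ (hn ▸ h4) h1 h2 h3 rfl

lemma closed_of_cycle {es : List E} (h : IsCycle s r es) :
    ∃ v, es ≠ [] ∧ Pth s r v es ∧ src s v es = v := by
  obtain ⟨hne, h1, h2, -⟩ := h
  exact ⟨_, hne, pth_of_chain hne h1, by rw [src_head hne, h2]⟩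

lemma exists_pth_of_transGen {v w : V} (h : Relation.TransGen (Step s r) v w) :
    ∃ l, l ≠ [] ∧ Pth s r w l ∧ src s w l = v := by
  induction h using Relation.TransGen.head_induction_on with
  | single h =>
    obtain ⟨e, h1, h2⟩ := h
    exact ⟨[e], by simp, ⟨h2, trivial⟩, h1⟩
  | head h _ ih =>
    obtain ⟨e, h1, h2⟩ := h
    obtain ⟨l, h3, h4, h5⟩ := ih
    exact ⟨e :: l, by simp, ⟨h2.trans h5.symm, h4⟩, h1⟩

lemma irrefl_of_acyclic (h : ¬ ∃ es, IsCycle s r es) (v : V) :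
    ¬ Relation.TransGen (Step s r) v v := by
  intro hv
  obtain ⟨l, h1, h2, h3⟩ := exists_pth_of_transGen hv
  exact h (exists_cycle_of_closed h1 h2 h3)

lemma Pth.transGen {w : V} {e : E} {t : List E} (h : Pth s r w (e :: t)) {f : E} (hf : f ∈ t) :
    Relation.TransGen (Step s r) (s e) (s f) := by
  induction t generalizing e with
  | nil => simp at hf
  | cons g t ih =>
    have h1 : Step s r (s e) (s g) := ⟨e, rfl, h.1⟩
    rcases List.mem_cons.1 hf with rfl | hf
    · exact .single h1
    · exact .head h1 (ih h.2 hf)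

lemma Pth.nodup (ha : ¬ ∃ es, IsCycle s r es) {w : V} {l : List E} (h : Pth s r w l) :
    l.Nodup := by
  induction l with
  | nil => simp
  | cons e t ih =>
    exact List.nodup_cons.2 ⟨fun he => irrefl_of_acyclic ha _ (h.transGen he), ih h.2⟩

lemma finite_paths (ha : ¬ ∃ es, IsCycle s r es) (F : Finset E) (w : V) :
    Finite {l : List E // Pth s r w l ∧ ∀ e ∈ l, e ∈ F} := by
  classical
  let f : {l : List E // Pth s r w l ∧ ∀ e ∈ l, e ∈ F} → {l : List F // l.Nodup} :=
    fun l => ⟨l.1.attach.map (fun x => ⟨x.1, l.2.2 x.1 x.2⟩), by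
      refine List.Nodup.map ?_ (List.nodup_attach.2 (l.2.1.nodup ha))
      intro x y hxy
      simpa [Subtype.ext_iff] using hxy⟩
  refine Finite.of_injective f ?_
  intro x y hxy
  have h := congrArg (fun l : {l : List F // l.Nodup} => l.1.map Subtype.val) hxy
  simp [f, List.map_map, Function.comp_def] at h
  exact Subtype.ext h

end comb

/-! ### Basic relations -/

section rel
variable (K : Type) [Field K] {V E : Type} (s r : E → V)

/-- vertex -/
def vt (v : V) : LPAAmbient K V E s r := lpaGen K s r (.vertex v)
/-- edge -/
def ed (e : E) : LPAAmbient K V E s r := lpaGen K s r (.edge e)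
/-- ghost edge -/
def gh (e : E) : LPAAmbient K V E s r := lpaGen K s r (.ghost e)

lemma vt_mul_vt_ne {v w : V} (h : v ≠ w) : vt K s r v * vt K s r w = 0 := by
  simpa [vt, lpaGen] using RingQuot.mkRingHom_rel (LPARel.vertex_orth (K := K) (s := s) (r := r) v w h)
lemma vt_mul_vt (v : V) : vt K s r v * vt K s r v = vt K s r v := by
  simpa [vt, lpaGen] using RingQuot.mkRingHom_rel (LPARel.vertex_idem (K := K) (s := s) (r := r) v)
lemma vt_mul_ed (e : E) : vt K s r (s e) * ed K s r e = ed K s r e := by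
  simpa [vt, ed, lpaGen] using RingQuot.mkRingHom_rel (LPARel.edge_src (K := K) (s := s) (r := r) e)
lemma ed_mul_vt (e : E) : ed K s r e * vt K s r (r e) = ed K s r e := by
  simpa [vt, ed, lpaGen] using RingQuot.mkRingHom_rel (LPARel.edge_rng (K := K) (s := s) (r := r) e)
lemma vt_mul_gh (e : E) : vt K s r (r e) * gh K s r e = gh K s r e := by
  simpa [vt, gh, lpaGen] using RingQuot.mkRingHom_rel (LPARel.ghost_rng (K := K) (s := s) (r := r) e)
lemma gh_mul_vt (e : E) : gh K s r e * vt K s r (s e) = gh K s r e := by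
  simpa [vt, gh, lpaGen] using RingQuot.mkRingHom_rel (LPARel.ghost_src (K := K) (s := s) (r := r) e)
lemma gh_mul_ed_ne {e f : E} (h : e ≠ f) : gh K s r e * ed K s r f = 0 := by
  simpa [ed, gh, lpaGen] using RingQuot.mkRingHom_rel (LPARel.ck1_distinct (K := K) (s := s) (r := r) e f h)
lemma gh_mul_ed (e : E) : gh K s r e * ed K s r e = vt K s r (r e) := by
  simpa [ed, gh, vt, lpaGen] using RingQuot.mkRingHom_rel (LPARel.ck1_same (K := K) (s := s) (r := r) e)
lemma vt_ck2 (v : V) (h : {e : E | s e = v}.Finite) (hne : {e : E | s e = v}.Nonempty) :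
    vt K s r v = ∑ e ∈ h.toFinset, ed K s r e * gh K s r e := by
  simpa [ed, gh, vt, lpaGen] using RingQuot.mkRingHom_rel (LPARel.ck2 (K := K) (s := s) (r := r) v h hne)

lemma vt_mul_ed_ne {v : V} {e : E} (h : v ≠ s e) : vt K s r v * ed K s r e = 0 := by
  rw [← vt_mul_ed, ← mul_assoc, vt_mul_vt_ne K s r h, zero_mul]
lemma gh_mul_vt_ne {v : V} {e : E} (h : v ≠ s e) : gh K s r e * vt K s r v = 0 := by
  rw [← gh_mul_vt, mul_assoc, vt_mul_vt_ne K s r h.symm, mul_zero]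

/-- product of edges -/
def pe (l : List E) : LPAAmbient K V E s r := (l.map (ed K s r)).prod
/-- product of ghosts -/
def pg : List E → LPAAmbient K V E s r
  | [] => 1
  | e :: l => pg l * gh K s r e

lemma pe_nil : pe K s r [] = 1 := rfl
lemma pe_cons (e : E) (l : List E) : pe K s r (e :: l) = ed K s r e * pe K s r l := by simp [pe]
lemma pg_nil : pg K s r [] = 1 := rfl
lemma pg_cons (e : E) (l : List E) : pg K s r (e :: l) = pg K s r l * gh K s r e := rfl

lemma src_mul_pe {w : V} (l : List E) {x : LPAAmbient K V E s r} (hx : vt K s r w * x = x) :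
    vt K s r (src s w l) * (pe K s r l * x) = pe K s r l * x := by
  cases l with
  | nil => simpa [pe, src] using hx
  | cons e l => rw [pe_cons, src, mul_assoc, ← mul_assoc, vt_mul_ed]

lemma pg_mul_src {w : V} (l : List E) {x : LPAAmbient K V E s r} (hx : x * vt K s r w = x) :
    (x * pg K s r l) * vt K s r (src s w l) = x * pg K s r l := by
  cases l with
  | nil => simpa [pg, src] using hx
  | cons e l => rw [pg_cons, src, mul_assoc, mul_assoc, gh_mul_vt]

/-- universal property -/
lemma exists_lift {B : Type*} [Ring B] [Algebra K B] (v' : V → B) (e' g' : E → B)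
    (h1 : ∀ v w, v ≠ w → v' v * v' w = 0) (h2 : ∀ v, v' v * v' v = v' v)
    (h3 : ∀ e, v' (s e) * e' e = e' e) (h4 : ∀ e, e' e * v' (r e) = e' e)
    (h5 : ∀ e, v' (r e) * g' e = g' e) (h6 : ∀ e, g' e * v' (s e) = g' e)
    (h7 : ∀ e f, e ≠ f → g' e * e' f = 0) (h8 : ∀ e, g' e * e' e = v' (r e))
    (h9 : ∀ v (h : {e : E | s e = v}.Finite), {e : E | s e = v}.Nonempty →
      v' v = ∑ e ∈ h.toFinset, e' e * g' e) :
    ∃ φ : LPAAmbient K V E s r →ₐ[K] B, (∀ v, φ (vt K s r v) = v' v) ∧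
      (∀ e, φ (ed K s r e) = e' e) ∧ ∀ e, φ (gh K s r e) = g' e := by
  let f : FreeAlgebra K (LPAGen V E) →ₐ[K] B := FreeAlgebra.lift K (fun x => match x with
    | .vertex v => v' v
    | .edge e => e' e
    | .ghost e => g' e)
  have hf : ∀ ⦃x y⦄, LPARel K V E s r x y → f x = f y := by
    intro x y h
    cases h with
    | vertex_orth v w h => simpa [f] using h1 v w h
    | vertex_idem v => simpa [f] using h2 v
    | edge_src e => simpa [f] using h3 e
    | edge_rng e => simpa [f] using h4 e
    | ghost_rng e => simpa [f] using h5 e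
    | ghost_src e => simpa [f] using h6 e
    | ck1_distinct e e2 h => simpa [f] using h7 e e2 h
    | ck1_same e => simpa [f] using h8 e
    | ck2 v h hne => simpa [f] using h9 v h hne
  have key : ∀ g, RingQuot.liftAlgHom K ⟨f, hf⟩ (lpaGen K s r g) = f (FreeAlgebra.ι K g) := by
    intro g
    rw [← RingQuot.liftAlgHom_mkAlgHom_apply K f hf]
    congr 1
    rw [lpaGen, ← RingQuot.mkAlgHom_coe K]
    rfl
  refine ⟨RingQuot.liftAlgHom K ⟨f, hf⟩, fun v => ?_, fun v => ?_, fun v => ?_⟩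
  · rw [vt, key]; simp [f]
  · rw [ed, key]; simp [f]
  · rw [gh, key]; simp [f]

end rel

/-! ### Vertices are nonzero -/

section nonzero
variable {V E : Type} {s r : E → V}

lemma exists_enc [Nonempty E] (s : E → V) : ∃ (I : Type) (_ : Nonempty I) (enc : E → I → I),
    (∀ e f i j, s e = s f → enc e i = enc f j → e = f ∧ i = j) ∧
    ∀ v, {e : E | s e = v}.Nonempty → ∀ j, ∃ e i, s e = v ∧ enc e i = j := by
  classical
  let I := ℕ ⊕ E
  have hI : Cardinal.aleph0 ≤ Cardinal.mk I := Cardinal.infinite_iff.1 inferInstance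
  have hσ : ∀ v, {e : E | s e = v}.Nonempty → Nonempty (I × {e : E | s e = v} ≃ I) := by
    intro v hv
    rw [← Cardinal.eq]
    simp only [Cardinal.mk_prod, Cardinal.lift_id]
    refine Cardinal.mul_eq_left hI ?_ ?_
    · exact Cardinal.mk_le_of_injective (f := fun x => Sum.inr x.1)
        (fun x y h => Subtype.ext (Sum.inr_injective h))
    · have := hv.to_subtype
      exact Cardinal.mk_ne_zero _
  let σ : ∀ v, {e : E | s e = v}.Nonempty → (I × {e : E | s e = v} ≃ I) :=
    fun v hv => (hσ v hv).some
  refine ⟨I, inferInstance, fun e i => σ (s e) ⟨e, rfl⟩ (i, ⟨e, rfl⟩), ?_, ?_⟩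
  · intro e f i j hs h
    have gen : ∀ v (h1 : s e = v) (h2 : s f = v) (p q : {e : E | s e = v}.Nonempty),
        σ v p (i, ⟨e, h1⟩) = σ v q (j, ⟨f, h2⟩) → e = f ∧ i = j := by
      intro v h1 h2 p q h
      have := (σ v p).injective h
      simp at this
      tauto
    have gen2 : ∀ v (h : s e = v), σ (s e) ⟨e, rfl⟩ (i, ⟨e, rfl⟩) = σ v ⟨e, h⟩ (i, ⟨e, h⟩) := by
      rintro v rfl; rfl
    exact gen (s f) hs rfl ⟨e, hs⟩ ⟨f, rfl⟩ ((gen2 _ hs).symm.trans h)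
  · intro v hv j
    obtain ⟨⟨i, e, he⟩, h⟩ := (σ v hv).surjective j
    refine ⟨e, i, he, ?_⟩
    have he' : s e = v := he
    subst he'
    exact h

lemma vt_ne_zero (K : Type) [Field K] [Nonempty E] (s r : E → V) (v : V) : vt K s r v ≠ 0 := by
  classical
  obtain ⟨I, hI, enc, inj, surj⟩ := exists_enc s
  have inj1 : ∀ e, Function.Injective (enc e) := fun e i j h => (inj e e i j rfl h).2
  let dec : E → I → Option I := fun e => Function.partialInv (enc e)
  have hdec : ∀ e i j, dec e j = some i ↔ enc e i = j :=
    fun e => (inj1 e).isPartialInv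
  let v' : V → Module.End K (V × I → K) := fun v =>
    { toFun := fun x p => if p.1 = v then x p else 0
      map_add' := by intro x y; funext p; by_cases h : p.1 = v <;> simp [h]
      map_smul' := by intro x y; funext p; by_cases h : p.1 = v <;> simp [h] }
  let e' : E → Module.End K (V × I → K) := fun e =>
    { toFun := fun x p => if p.1 = s e then (dec e p.2).elim 0 (fun i => x (r e, i)) else 0
      map_add' := by
        intro x y; funext p; by_cases h : p.1 = s e <;> cases hd : dec e p.2 <;> simp [h, hd]
      map_smul' := by
        intro x y; funext p; by_cases h : p.1 = s e <;> cases hd : dec e p.2 <;> simp [h, hd] }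
  let g' : E → Module.End K (V × I → K) := fun e =>
    { toFun := fun x p => if p.1 = r e then x (s e, enc e p.2) else 0
      map_add' := by intro x y; funext p; by_cases h : p.1 = r e <;> simp [h]
      map_smul' := by intro x y; funext p; by_cases h : p.1 = r e <;> simp [h] }
  have v'_apply : ∀ v x p, v' v x p = if p.1 = v then x p else 0 := fun _ _ _ => rfl
  have e'_apply : ∀ e x p, e' e x p =
    if p.1 = s e then (dec e p.2).elim 0 (fun i => x (r e, i)) else 0 := fun _ _ _ => rfl
  have g'_apply : ∀ e x p, g' e x p = if p.1 = r e then x (s e, enc e p.2) else 0 :=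
    fun _ _ _ => rfl
  have dec_enc : ∀ e i, dec e (enc e i) = some i := fun e i => (hdec e i _).2 rfl
  obtain ⟨φ, hφ, -, -⟩ := exists_lift K s r v' e' g'
    (by
      intro v w h; ext1 x; funext p
      simp only [Module.End.mul_apply, v'_apply, LinearMap.zero_apply, Pi.zero_apply]
      split_ifs with h1 h2 <;> simp_all)
    (by
      intro v; ext1 x; funext p
      simp only [Module.End.mul_apply, v'_apply]
      split_ifs <;> rfl)
    (by
      intro v; ext1 x; funext p
      simp only [Module.End.mul_apply, v'_apply, e'_apply]
      split_ifs <;> rfl)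
    (by
      intro v; ext1 x; funext p
      simp only [Module.End.mul_apply, v'_apply, e'_apply, if_true])
    (by
      intro v; ext1 x; funext p
      simp only [Module.End.mul_apply, v'_apply, g'_apply]
      split_ifs <;> rfl)
    (by
      intro v; ext1 x; funext p
      simp only [Module.End.mul_apply, v'_apply, g'_apply, if_true])
    (by
      intro e f hef; ext1 x; funext p
      simp only [Module.End.mul_apply, e'_apply, g'_apply, LinearMap.zero_apply, Pi.zero_apply]
      split_ifs with h1 h2
      · cases hd : dec f (enc e p.2) with
        | none => rfl
        | some i => exact absurd (inj e f _ _ h2 ((hdec _ _ _).1 hd).symm).1 hef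
      · rfl
      · rfl)
    (by
      intro e; ext1 x; funext p
      obtain ⟨w, i⟩ := p
      simp only [Module.End.mul_apply, e'_apply, g'_apply, v'_apply, if_true, dec_enc]
      split_ifs with h1
      · subst h1; rfl
      · rfl)
    (by
      intro v hfin hne; ext1 x; funext p
      obtain ⟨w, j⟩ := p
      simp only [LinearMap.sum_apply, Finset.sum_apply, Module.End.mul_apply, e'_apply, g'_apply,
        v'_apply, if_true]
      split_ifs with h1
      · subst h1
        obtain ⟨e, i, he, hij⟩ := surj w hne j
        rw [Finset.sum_eq_single e]
        · subst he; subst hij; simp [dec_enc]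
        · intro f hf hfe
          have hf' : s f = w := by simpa using hf
          rw [if_pos hf'.symm]
          cases hd : dec f j with
          | none => rfl
          | some i' =>
            exact absurd (inj f e _ _ (hf'.trans he.symm) (((hdec _ _ _).1 hd).trans hij.symm)).1 hfe
        · intro h; exact absurd (by simpa using he) h
      · symm
        apply Finset.sum_eq_zero
        intro f hf
        have hf' : s f = v := by simpa using hf
        rw [if_neg (by rw [hf']; exact h1)])
  intro h0
  have h1 := hφ v
  rw [h0, map_zero] at h1
  have h2 := congrFun (LinearMap.congr_fun h1 (fun _ => (1 : K))) (v, Classical.arbitrary I)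
  simp [v'_apply] at h2

end nonzero

/-! ### Grading -/

section grading
variable (K : Type) [Field K] {V E : Type} (s r : E → V)

lemma exists_grading : ∃ φ : LPAAmbient K V E s r →ₐ[K] AddMonoidAlgebra (LPAAmbient K V E s r) ℤ,
    (∀ v, φ (vt K s r v) = AddMonoidAlgebra.single 0 (vt K s r v)) ∧
    (∀ e, φ (ed K s r e) = AddMonoidAlgebra.single 1 (ed K s r e)) ∧
    (∀ e, φ (gh K s r e) = AddMonoidAlgebra.single (-1) (gh K s r e)) := by
  refine exists_lift K s r (fun v => AddMonoidAlgebra.single 0 (vt K s r v))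
    (fun e => AddMonoidAlgebra.single 1 (ed K s r e))
    (fun e => AddMonoidAlgebra.single (-1) (gh K s r e)) ?_ ?_ ?_ ?_ ?_ ?_ ?_ ?_ ?_
  · intro v w h; simp only [AddMonoidAlgebra.single_mul_single, add_zero, zero_add, neg_add_cancel,
      AddMonoidAlgebra.single_zero, vt_mul_vt_ne K s r h]
  · intro v; simp only [AddMonoidAlgebra.single_mul_single, add_zero, zero_add, neg_add_cancel,
      AddMonoidAlgebra.single_zero, vt_mul_vt]
  · intro v; simp only [AddMonoidAlgebra.single_mul_single, add_zero, zero_add, neg_add_cancel,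
      AddMonoidAlgebra.single_zero, vt_mul_ed]
  · intro v; simp only [AddMonoidAlgebra.single_mul_single, add_zero, zero_add, neg_add_cancel,
      AddMonoidAlgebra.single_zero, ed_mul_vt]
  · intro v; simp only [AddMonoidAlgebra.single_mul_single, add_zero, zero_add, neg_add_cancel,
      AddMonoidAlgebra.single_zero, vt_mul_gh]
  · intro v; simp only [AddMonoidAlgebra.single_mul_single, add_zero, zero_add, neg_add_cancel,
      AddMonoidAlgebra.single_zero, gh_mul_vt]
  · intro e f h; simp only [AddMonoidAlgebra.single_mul_single, add_zero, zero_add, neg_add_cancel,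
      AddMonoidAlgebra.single_zero, gh_mul_ed_ne K s r h]
  · intro v; simp only [AddMonoidAlgebra.single_mul_single, add_zero, zero_add, neg_add_cancel,
      AddMonoidAlgebra.single_zero, gh_mul_ed]
  · intro v h hne
    simp only [AddMonoidAlgebra.single_mul_single, add_neg_cancel]
    conv_lhs => rw [vt_ck2 K s r v h hne]
    exact map_sum (AddMonoidAlgebra.singleAddHom (0 : ℤ)) _ _

end grading

section shift
variable {A : Type*} [Ring A]

lemma shift_zero {k : ℤ} (hk : 0 < k) (f : ℤ →₀ A) (T : A → A) (hT : T 0 = 0) (M : ℤ)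
    (h : ∀ i < M, f i = T (f (i - k))) : ∀ i < M, f i = 0 := by
  obtain ⟨N, hN⟩ : ∃ N, ∀ i < N, f i = 0 := by
    obtain ⟨N, hN⟩ := f.support.bddBelow
    refine ⟨N, fun i hi => ?_⟩
    by_contra hc
    have := hN (by simpa using hc : i ∈ (f.support : Set ℤ))
    omega
  have : ∀ n : ℕ, ∀ i < N + n, i < M → f i = 0 := by
    intro n
    induction n with
    | zero => intro i hi _; exact hN i (by simpa using hi)
    | succ n ih =>
      intro i hi hM
      rw [h i hM, ih (i - k) (by push_cast at hi; omega) (by omega), hT]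
  intro i hi
  exact this (i - N + 1).toNat i (by omega) hi

lemma shift_false {k : ℤ} (hk : 0 < k) (f : ℤ →₀ A) (T : A → A) (hT : T 0 = 0) (v : A)
    (h : ∀ i, f i = (if i = 0 then v else 0) + T (f (i - k)))
    (t : ℕ → A) (h0 : t 0 = v) (h1 : ∀ n, t (n + 1) = T (t n)) (ht : ∀ n, t n ≠ 0) : False := by
  have hz := shift_zero hk f T hT 0 (fun i hi => by
    have := h i
    rw [if_neg hi.ne, zero_add] at this; exact this)
  have key : ∀ n : ℕ, f (n * k) = t n := by
    intro n
    induction n with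
    | zero => rw [h, hz _ (by simpa using hk), h0, hT]; simp
    | succ n ih =>
      have e : ((n + 1 : ℕ) : ℤ) * k - k = n * k := by push_cast; ring
      rw [h, e, ih, h1, if_neg (by positivity), zero_add]
  have hinj : Function.Injective (fun n : ℕ => (n : ℤ) * k) := by
    intro a b hab
    simpa [hk.ne'] using hab
  exact (Set.infinite_of_injective_forall_mem (s := (f.support : Set ℤ)) hinj (fun n => by
    simpa [key] using ht n)) f.support.finite_toSet

open AddMonoidAlgebra in
lemma no_inverse {v c g : A} {k : ℤ} (hk : 0 < k) (hv0 : v ≠ 0) (hv : v * v = v)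
    (hvc : v * c = c) (hcv : c * v = c) (hg : g * c = v) (Y : AddMonoidAlgebra A ℤ) :
    (Y * single 0 v = Y → Y * (single 0 v + single k c) ≠ single 0 v) ∧
    (single 0 v * Y = Y → (single 0 v + single k c) * Y ≠ single 0 v) ∧
    (Y * single 0 v = Y → Y * (single 0 v + single k c) = 0 → Y = 0) ∧
    (single 0 v * Y = Y → (single 0 v + single k c) * Y = 0 → Y = 0) := by
  have hn : ∀ n : ℕ, (-c) ^ n * v ≠ 0 := by
    intro n
    induction n with
    | zero => simpa using hv0
    | succ n ih =>
      intro h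
      apply ih
      have h2 : (-g) * ((-c) ^ (n + 1) * v) = (-c) ^ n * v := by
        rw [pow_succ', mul_assoc (-c), ← mul_assoc (-g), neg_mul_neg, hg]
        cases n with
        | zero => simpa using hv
        | succ n => rw [pow_succ', ← mul_assoc, ← mul_assoc, mul_neg, hvc]
      rw [← h2, h, mul_zero]
  have hcomm : ∀ n : ℕ, v * (-c) ^ n = (-c) ^ n * v := by
    intro n
    have : Commute v (-c) := by
      rw [Commute, SemiconjBy, mul_neg, neg_mul, hvc, hcv]
    exact this.pow_right n
  have hs : ∀ i, (single (0 : ℤ) v).coeff i = if i = 0 then v else 0 := by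
    intro i
    rw [AddMonoidAlgebra.coeff_single, Finsupp.single_apply]
    simp only [eq_comm]
  have R : Y * single 0 v = Y → ∀ i, (Y * (single 0 v + single k c)).coeff i =
      Y.coeff i + Y.coeff (i - k) * c := by
    intro h i
    rw [mul_add, h, AddMonoidAlgebra.coeff_add, Finsupp.add_apply, coeff_mul_single_apply,
      sub_eq_add_neg]
  have L : single 0 v * Y = Y → ∀ i, ((single 0 v + single k c) * Y).coeff i =
      Y.coeff i + c * Y.coeff (i - k) := by
    intro h i
    rw [add_mul, h, AddMonoidAlgebra.coeff_add, Finsupp.add_apply, coeff_single_mul_apply,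
      sub_eq_add_neg, add_comm (-k)]
  refine ⟨fun h1 h2 => ?_, fun h1 h2 => ?_, fun h1 h2 => ?_, fun h1 h2 => ?_⟩
  · refine shift_false hk Y.coeff (fun x => x * (-c)) (by simp) v (fun i => ?_)
      (fun n => v * (-c) ^ n) (by simp) (fun n => by simp [pow_succ, mul_assoc])
      (fun n => by rw [hcomm]; exact hn n)
    rw [← hs, ← h2, R h1]; simp
  · refine shift_false hk Y.coeff (fun x => (-c) * x) (by simp) v (fun i => ?_)
      (fun n => (-c) ^ n * v) (by simp) (fun n => by simp only [pow_succ', mul_assoc]) hn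
    rw [← hs, ← h2, L h1]; simp
  · ext i
    refine shift_zero hk Y.coeff (fun x => x * (-c)) (by simp) (i + 1) (fun j _ => ?_) i (by omega)
    have := R h1 j
    rw [h2] at this
    rw [mul_neg]
    exact eq_neg_of_add_eq_zero_left this.symm
  · ext i
    refine shift_zero hk Y.coeff (fun x => (-c) * x) (by simp) (i + 1) (fun j _ => ?_) i (by omega)
    have := L h1 j
    rw [h2] at this
    rw [neg_mul]
    exact eq_neg_of_add_eq_zero_left this.symm

end shift

section cyc
variable (K : Type) [Field K] {V E : Type} (s r : E → V)

lemma pg_mul_pe {w : V} {l : List E} (h : Pth s r w l) :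
    pg K s r l * (pe K s r l * vt K s r w) = vt K s r w := by
  induction l with
  | nil => simp [pg_nil, pe_nil]
  | cons e l ih =>
    rw [pg_cons, pe_cons, mul_assoc, mul_assoc, ← mul_assoc (gh K s r e), gh_mul_ed, h.1,
      src_mul_pe K s r l (vt_mul_vt K s r w), ih h.2]

lemma pe_mul_vt {w : V} {l : List E} (h : Pth s r w l) (hne : l ≠ []) :
    pe K s r l * vt K s r w = pe K s r l := by
  induction l with
  | nil => exact absurd rfl hne
  | cons e l ih =>
    cases l with
    | nil =>
      have h1 : r e = w := h.1
      rw [pe_cons, pe_nil, mul_one, ← h1, ed_mul_vt]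
    | cons f l => rw [pe_cons, mul_assoc, ih h.2 (by simp)]

lemma main_cyc {es : List E} (h : IsCycle s r es) :
    ∃ a : LeavittPathAlgebraNU K V E s r,
      (∀ (b : LPAAmbient K V E s r) (n : ℕ), (a : LPAAmbient K V E s r) ^ (n + 1) ≠
          a ^ (n + 1) * b * a ^ (n + 1)) ∧
      (∀ (b : LPAAmbient K V E s r) (n : ℕ), (a : LPAAmbient K V E s r) ^ (n + 1) ≠
          b * a ^ (n + 2)) ∧
      (∀ (b : LPAAmbient K V E s r) (n : ℕ), (a : LPAAmbient K V E s r) ^ (n + 1) ≠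
          a ^ (n + 2) * b) := by
  obtain ⟨w, hne, hp, hs⟩ := closed_of_cycle h
  have : Nonempty E := ⟨es.head hne⟩
  obtain ⟨φ, hφv, hφe, -⟩ := exists_grading K s r
  have hφ : ∀ l : List E, φ (pe K s r l) = AddMonoidAlgebra.single (l.length : ℤ) (pe K s r l) := by
    intro l
    induction l with
    | nil => simp only [pe_nil, map_one]; rfl
    | cons e l ih =>
      rw [pe_cons, map_mul, ih, hφe, AddMonoidAlgebra.single_mul_single]
      congr 1
      simp [add_comm]
  set v := vt K s r w with hv
  set c := pe K s r es with hc
  have hk : 0 < (es.length : ℤ) := by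
    have := List.length_pos_iff.2 hne; omega
  have hcv : c * v = c := pe_mul_vt K s r hp hne
  have hvv : v * v = v := vt_mul_vt K s r w
  have hvc : v * c = c := by
    have := src_mul_pe K s r es hvv
    rw [hs] at this
    rwa [← hcv]
  have hg : pg K s r es * c = v := by
    have := pg_mul_pe K s r hp
    rwa [pe_mul_vt K s r hp hne] at this
  have N := no_inverse (k := es.length) hk (vt_ne_zero K s r w) hvv hvc hcv hg
  have hmem : v + c ∈ LeavittPathAlgebraNU K V E s r := by
    have hg : ∀ g, lpaGen K s r g ∈ LeavittPathAlgebraNU K V E s r :=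
      fun g => NonUnitalAlgebra.subset_adjoin K ⟨g, rfl⟩
    have : ∀ l : List E, pe K s r l * v ∈ LeavittPathAlgebraNU K V E s r := by
      intro l
      induction l with
      | nil => rw [pe_nil, one_mul]; exact hg _
      | cons e l ih => rw [pe_cons, mul_assoc]; exact mul_mem (hg _) ih
    exact add_mem (hg _) (hcv ▸ this es)
  set a := v + c with ha
  have hva : v * a = a := by rw [ha, mul_add, hvv, hvc]
  have hav : a * v = a := by rw [ha, add_mul, hvv, hcv]
  have hvan : ∀ n : ℕ, v * a ^ (n + 1) = a ^ (n + 1) := by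
    intro n; rw [pow_succ', ← mul_assoc, hva]
  have hanv : ∀ n : ℕ, a ^ (n + 1) * v = a ^ (n + 1) := by
    intro n; rw [pow_succ, mul_assoc, hav]
  have hφa : φ a = AddMonoidAlgebra.single 0 v + AddMonoidAlgebra.single (es.length : ℤ) c := by
    rw [ha, map_add, hφv, hφ]
  -- cancellation
  have N1 : ∀ y, y * v = y → φ y * φ a = φ v → False := by
    intro y h1 h2
    rw [hφa, hφv] at h2
    exact (N (φ y)).1 (by rw [← hφv, ← map_mul, h1]) h2
  have N2 : ∀ y, v * y = y → φ a * φ y = φ v → False := by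
    intro y h1 h2
    rw [hφa, hφv] at h2
    exact (N (φ y)).2.1 (by rw [← hφv, ← map_mul, h1]) h2
  have N3 : ∀ n : ℕ, ∀ y, y * v = y → φ y * φ a ^ n = 0 → φ y = 0 := by
    intro n
    induction n with
    | zero => intro y _ h; simpa using h
    | succ n ih =>
      intro y h1 h2
      have := ih (y * a) (by rw [mul_assoc, hav]) (by rw [map_mul, mul_assoc, ← pow_succ', h2])
      rw [map_mul, hφa] at this
      exact (N (φ y)).2.2.1 (by rw [← hφv, ← map_mul, h1]) this
  have N4 : ∀ n : ℕ, ∀ y, v * y = y → φ a ^ n * φ y = 0 → φ y = 0 := by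
    intro n
    induction n with
    | zero => intro y _ h; simpa using h
    | succ n ih =>
      intro y h1 h2
      have := ih (a * y) (by rw [← mul_assoc, hva]) (by rw [map_mul, ← mul_assoc, ← pow_succ, h2])
      rw [map_mul, hφa] at this
      exact (N (φ y)).2.2.2 (by rw [← hφv, ← map_mul, h1]) this
  refine ⟨⟨a, hmem⟩, ?_, ?_, ?_⟩
  · intro b n h
    simp only at h
    have h3 := N3 (n + 1) (a ^ (n + 1) * b * v - v) (by rw [sub_mul, mul_assoc, hvv]) (by
      rw [← map_pow, ← map_mul, sub_mul, hvan, mul_assoc, hvan, ← h, sub_self, map_zero])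
    rw [map_sub, sub_eq_zero] at h3
    refine N2 (v * a ^ n * b * v) (by simp only [← mul_assoc, hvv]) ?_
    rw [← map_mul, ← h3]
    congr 1
    simp only [← mul_assoc, hav, pow_succ']
  · intro b n h
    simp only at h
    have h3 := N3 (n + 1) (b * a - v) (by rw [sub_mul, mul_assoc, hvv, hav]) (by
      rw [← map_pow, ← map_mul, sub_mul, hvan, mul_assoc, ← pow_succ', ← h, sub_self, map_zero])
    rw [map_sub, sub_eq_zero] at h3
    refine N1 (b * v) (by rw [mul_assoc, hvv]) ?_
    rw [← map_mul, ← h3, mul_assoc, hva]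
  · intro b n h
    simp only at h
    have h3 := N4 (n + 1) (a * b - v) (by rw [mul_sub, ← mul_assoc, hvv, hva]) (by
      rw [← map_pow, ← map_mul, mul_sub, hanv, ← mul_assoc, ← pow_succ, ← h, sub_self, map_zero])
    rw [map_sub, sub_eq_zero] at h3
    refine N2 (v * b) (by rw [← mul_assoc, hvv]) ?_
    rw [← map_mul, ← h3, ← mul_assoc, hav]

end cyc

/-! ### Regularity of finite-dimensional pieces -/

section findim
variable {K : Type} [Field K]

lemma matrix_regular {n : Type*} [Fintype n] [DecidableEq n] (M : Matrix n n K) :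
    ∃ N : Matrix n n K, M = M * N * M := by
  let f := Matrix.toLin' M
  obtain ⟨g, hg⟩ := f.rangeRestrict.exists_rightInverse_of_surjective f.range_rangeRestrict
  obtain ⟨h, hh⟩ := (LinearMap.range f).subtype.exists_leftInverse_of_injective
    (Submodule.ker_subtype _)
  refine ⟨LinearMap.toMatrix' (g ∘ₗ h), ?_⟩
  apply Matrix.toLin'.injective
  rw [Matrix.toLin'_mul, Matrix.toLin'_mul, Matrix.toLin'_toMatrix']
  ext1 x
  ext1
  change f _ = f (g (h (f _)))
  have h1 : ∀ x, h (f x) = f.rangeRestrict x := fun x =>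
    LinearMap.congr_fun hh (f.rangeRestrict x)
  have h2 : ∀ y, f (g y) = y := fun y => congrArg Subtype.val (LinearMap.congr_fun hg y)
  rw [h1, h2]
  rfl

lemma strongly_pi {R : Type*} [Ring R] [Algebra K R] [FiniteDimensional K R] (x : R) :
    ∃ (y : R) (n : ℕ), x ^ (n + 1) = y * x ^ (n + 2) ∧ x ^ (n + 1) = x ^ (n + 2) * y := by
  have hInt : IsIntegral K x := IsIntegral.of_finite K x
  obtain ⟨q, hq, hd⟩ := Polynomial.exists_eq_pow_rootMultiplicity_mul_and_not_dvd
    (minpoly K x) (minpoly.ne_zero hInt) 0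
  set n := (minpoly K x).rootMultiplicity 0
  have h0 := minpoly.aeval K x
  rw [hq] at h0
  have hc : q.coeff 0 ≠ 0 := by
    intro h
    apply hd
    rw [map_zero, sub_zero]
    exact Polynomial.X_dvd_iff.2 h
  set Q := Polynomial.aeval x q.divX with hQ
  have hcomm : Commute Q x := by
    have : Commute (Polynomial.aeval x q.divX) (Polynomial.aeval x (Polynomial.X : Polynomial K)) := by
      rw [Commute, SemiconjBy, ← map_mul, ← map_mul, mul_comm]
    simpa using this
  have h1 : x ^ n * (Q * x + algebraMap K R (q.coeff 0)) = 0 := by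
    conv at h0 => rw [← Polynomial.divX_mul_X_add q]
    simpa using h0
  have h2 : x ^ n = x ^ (n + 1) * (-(q.coeff 0)⁻¹ • Q) := by
    rw [mul_add, ← Algebra.commutes, ← Algebra.smul_def] at h1
    have h3 : x ^ n = (q.coeff 0)⁻¹ • (-(x ^ n * (Q * x))) := by
      rw [← eq_neg_of_add_eq_zero_right h1, smul_smul, inv_mul_cancel₀ hc, one_smul]
    rw [hcomm.eq, ← mul_assoc, ← pow_succ] at h3
    rw [mul_smul_comm, neg_smul, ← smul_neg]
    exact h3
  have hcomm2 : Commute (-(q.coeff 0)⁻¹ • Q) x := hcomm.smul_left _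
  have h4 : x ^ (n + 1) = x ^ (n + 2) * (-(q.coeff 0)⁻¹ • Q) := by
    rw [pow_succ' x n, pow_succ' x (n + 1), mul_assoc, ← h2]
  exact ⟨_, n, by rw [(hcomm2.pow_right _).eq]; exact h4, h4⟩

lemma exists_hom {ι : Type*} [Fintype ι] (P : ι → Type*) [∀ i, Fintype (P i)]
    {A : Type*} [Ring A] [Algebra K A] (e : ∀ i, P i → P i → A)
    (h1 : ∀ i p q q', e i p q * e i q q' = e i p q')
    (h2 : ∀ i p q p' q', q ≠ p' → e i p q * e i p' q' = 0)
    (h3 : ∀ i j p q p' q', i ≠ j → e i p q * e j p' q' = 0) :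
    ∃ ψ : (∀ i, Matrix (P i) (P i) K) →ₙₐ[K] A,
      ∀ M, ψ M = ∑ i, ∑ p, ∑ q, M i p q • e i p q := by
  classical
  let f : ∀ i, Matrix (P i) (P i) K → A := fun i M => ∑ p, ∑ q, M p q • e i p q
  have hf : ∀ i M N, f i (M * N) = f i M * f i N := by
    intro i M N
    simp only [f, Finset.sum_mul_sum, Matrix.mul_apply, Finset.sum_smul]
    refine Finset.sum_congr rfl fun p _ => ?_
    rw [Finset.sum_comm' (t' := Finset.univ) (s' := fun _ => Finset.univ) (by simp)]
    rw [Finset.sum_comm]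
    rw [Finset.sum_comm]
    -- `∑ q', ∑ q, M p q * N q q' • e p q'`
    have : ∀ p', ∑ q, ∑ q', (M p q • e i p q) * (N p' q' • e i p' q') =
        ∑ q', (M p p' * N p' q') • e i p q' := by
      intro p'
      rw [Finset.sum_eq_single p']
      · refine Finset.sum_congr rfl fun q' _ => ?_
        rw [smul_mul_smul_comm, h1]
      · intro q _ hq
        refine Finset.sum_eq_zero fun q' _ => ?_
        rw [smul_mul_smul_comm, h2 _ _ _ _ _ hq, smul_zero]
      · simp
    rw [Finset.sum_congr rfl fun p' _ => this p']
  refine ⟨{ toFun := fun M => ∑ i, f i (M i), map_smul' := ?_, map_zero' := ?_, map_add' := ?_,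
            map_mul' := ?_ }, fun M => rfl⟩
  · intro c M
    simp [f, Finset.smul_sum, smul_smul]
  · simp [f]
  · intro M N
    simp [f, add_smul, Finset.sum_add_distrib]
  · intro M N
    simp only [Pi.mul_apply, hf, Finset.sum_mul_sum]
    refine Finset.sum_congr rfl fun i _ => ?_
    rw [Finset.sum_eq_single i]
    · intro j _ hj
      simp only [f, Finset.sum_mul_sum]
      refine Finset.sum_eq_zero fun p _ => Finset.sum_eq_zero fun p' _ =>
        Finset.sum_eq_zero fun q _ => Finset.sum_eq_zero fun q' _ => ?_
      rw [smul_mul_smul_comm, h3 _ _ _ _ _ _ hj.symm, smul_zero]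
    · simp

end findim

section acyc
variable (K : Type) [Field K] {V E : Type} (s r : E → V)

open Classical in
/-- the idempotent at `w` orthogonal to the edges of `F` -/
noncomputable def uu (F : Finset E) (w : V) : LPAAmbient K V E s r :=
  vt K s r w - ∑ f ∈ F.filter (fun f => s f = w), ed K s r f * gh K s r f

variable (F : Finset E)

lemma vt_mul_uu (w : V) : vt K s r w * uu K s r F w = uu K s r F w := by
  classical
  rw [uu, mul_sub, vt_mul_vt, Finset.mul_sum]
  congr 1
  refine Finset.sum_congr rfl fun f hf => ?_
  rw [← mul_assoc, ← (Finset.mem_filter.1 hf).2, vt_mul_ed]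

lemma uu_mul_vt (w : V) : uu K s r F w * vt K s r w = uu K s r F w := by
  classical
  rw [uu, sub_mul, vt_mul_vt, Finset.sum_mul]
  congr 1
  refine Finset.sum_congr rfl fun f hf => ?_
  rw [mul_assoc, ← (Finset.mem_filter.1 hf).2, gh_mul_vt]

lemma uu_mul_ed (w : V) {f : E} (hf : f ∈ F) : uu K s r F w * ed K s r f = 0 := by
  classical
  by_cases h : s f = w
  · subst h
    rw [uu, sub_mul, vt_mul_ed, Finset.sum_mul, Finset.sum_eq_single f]
    · rw [mul_assoc, gh_mul_ed, ed_mul_vt, sub_self]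
    · intro g _ hg
      rw [mul_assoc, gh_mul_ed_ne K s r hg, mul_zero]
    · intro h; exact (h (Finset.mem_filter.2 ⟨hf, rfl⟩)).elim
  · rw [← uu_mul_vt, mul_assoc, vt_mul_ed_ne K s r (Ne.symm h), mul_zero]

lemma gh_mul_uu (w : V) {f : E} (hf : f ∈ F) : gh K s r f * uu K s r F w = 0 := by
  classical
  by_cases h : s f = w
  · subst h
    rw [uu, mul_sub, gh_mul_vt, Finset.mul_sum, Finset.sum_eq_single f]
    · rw [← mul_assoc, gh_mul_ed, vt_mul_gh, sub_self]
    · intro g _ hg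
      rw [← mul_assoc, gh_mul_ed_ne K s r hg.symm, zero_mul]
    · intro h; exact (h (Finset.mem_filter.2 ⟨hf, rfl⟩)).elim
  · rw [← vt_mul_uu, ← mul_assoc, gh_mul_vt_ne K s r (Ne.symm h), zero_mul]

lemma uu_mul_uu (w : V) : uu K s r F w * uu K s r F w = uu K s r F w := by
  classical
  conv_lhs => lhs; rw [uu]
  rw [sub_mul, vt_mul_uu, Finset.sum_mul, Finset.sum_eq_zero, sub_zero]
  intro f hf
  rw [mul_assoc, gh_mul_uu K s r F _ (Finset.mem_filter.1 hf).1, mul_zero]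

lemma uu_mul_uu_ne {w w' : V} (h : w ≠ w') : uu K s r F w * uu K s r F w' = 0 := by
  rw [← uu_mul_vt, ← vt_mul_uu K s r F w', mul_assoc, ← mul_assoc (vt K s r w),
    vt_mul_vt_ne K s r h, zero_mul, mul_zero]

lemma mid_eq {w : V} {l : List E} (h : Pth s r w l) :
    uu K s r F w * (pg K s r l * (pe K s r l * uu K s r F w)) = uu K s r F w := by
  have h1 : pg K s r l * (pe K s r l * uu K s r F w) = uu K s r F w := by
    have := congrArg (· * uu K s r F w) (pg_mul_pe K s r h)
    simpa only [mul_assoc, vt_mul_uu] using this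
  rw [h1, uu_mul_uu]

lemma mid_ne {w w' : V} {l l' : List E} (h : Pth s r w l) (h' : Pth s r w' l')
    (hF : ∀ e ∈ l, e ∈ F) (hF' : ∀ e ∈ l', e ∈ F) (hne : w ≠ w' ∨ l ≠ l') :
    uu K s r F w * (pg K s r l * (pe K s r l' * uu K s r F w')) = 0 := by
  induction l generalizing l' with
  | nil =>
    cases l' with
    | nil => simpa [pg_nil, pe_nil] using uu_mul_uu_ne K s r F (by simpa using hne)
    | cons f t =>
      rw [pg_nil, pe_cons, one_mul, mul_assoc, ← mul_assoc, uu_mul_ed K s r F w (hF' f (by simp)),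
        zero_mul]
  | cons e t ih =>
    cases l' with
    | nil =>
      rw [pg_cons, pe_nil, one_mul, mul_assoc, gh_mul_uu K s r F w' (hF e (by simp)), mul_zero,
        mul_zero]
    | cons f t' =>
      rw [pg_cons, pe_cons, mul_assoc, mul_assoc, ← mul_assoc (gh K s r e)]
      by_cases hef : e = f
      · subst hef
        rw [gh_mul_ed, h'.1, src_mul_pe K s r t' (vt_mul_uu K s r F w')]
        exact ih h.2 h'.2 (fun g hg => hF g (by simp [hg])) (fun g hg => hF' g (by simp [hg]))
          (by simpa using hne)
      · rw [gh_mul_ed_ne K s r hef]; simp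

/-- matrix unit -/
noncomputable def mu (w : V) (p q : List E) : LPAAmbient K V E s r :=
  pe K s r p * uu K s r F w * pg K s r q

/-- span of matrix units with prescribed sources -/
def SS (W : Finset V) (v v' : V) : Submodule K (LPAAmbient K V E s r) :=
  Submodule.span K {x | ∃ w ∈ W, ∃ p q, (Pth s r w p ∧ ∀ e ∈ p, e ∈ F) ∧
    (Pth s r w q ∧ ∀ e ∈ q, e ∈ F) ∧ src s w p = v ∧ src s w q = v' ∧ x = mu K s r F w p q}

lemma ed_mul_SS {W : Finset V} {f : E} (hf : f ∈ F) {v' : V} {x : LPAAmbient K V E s r}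
    (hx : x ∈ SS K s r F W (r f) v') : ed K s r f * x ∈ SS K s r F W (s f) v' := by
  induction hx using Submodule.span_induction with
  | mem x hx =>
    obtain ⟨w, hw, p, q, h1, h2, h3, h4, rfl⟩ := hx
    refine Submodule.subset_span ⟨w, hw, f :: p, q, ⟨⟨h3.symm, h1.1⟩, ?_⟩, h2, rfl, h4, ?_⟩
    · intro e he
      rcases List.mem_cons.1 he with rfl | he
      · exact hf
      · exact h1.2 e he
    · simp only [mu, pe_cons, mul_assoc]
  | zero => rw [mul_zero]; exact zero_mem _
  | add x y _ _ hx hy => rw [mul_add]; exact add_mem hx hy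
  | smul c x _ hx => rw [mul_smul_comm]; exact Submodule.smul_mem _ _ hx

lemma SS_mul_gh {W : Finset V} {f : E} (hf : f ∈ F) {v : V} {x : LPAAmbient K V E s r}
    (hx : x ∈ SS K s r F W v (r f)) : x * gh K s r f ∈ SS K s r F W v (s f) := by
  induction hx using Submodule.span_induction with
  | mem x hx =>
    obtain ⟨w, hw, p, q, h1, h2, h3, h4, rfl⟩ := hx
    refine Submodule.subset_span ⟨w, hw, p, f :: q, h1, ⟨⟨h4.symm, h2.1⟩, ?_⟩, h3, rfl, ?_⟩
    · intro e he
      rcases List.mem_cons.1 he with rfl | he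
      · exact hf
      · exact h2.2 e he
    · simp only [mu, pg_cons, mul_assoc]
  | zero => rw [zero_mul]; exact zero_mem _
  | add x y _ _ hx hy => rw [add_mul]; exact add_mem hx hy
  | smul c x _ hx => rw [smul_mul_assoc]; exact Submodule.smul_mem _ _ hx

lemma vt_mem_SS (ha : ¬ ∃ es, IsCycle s r es) {W : Finset V} (hW : ∀ f ∈ F, r f ∈ W)
    {v : V} (hv : v ∈ W) : vt K s r v ∈ SS K s r F W v v := by
  classical
  let rel : W → W → Prop := fun a b => Relation.TransGen (Step s r) b.1 a.1
  have : IsTrans W rel := ⟨fun a b c h1 h2 => h2.trans h1⟩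
  have : Std.Irrefl rel := ⟨fun a => irrefl_of_acyclic ha a.1⟩
  have hwf : WellFounded rel := Finite.wellFounded_of_trans_of_irrefl rel
  suffices h : ∀ v : W, vt K s r v.1 ∈ SS K s r F W v.1 v.1 from h ⟨v, hv⟩
  intro v
  induction v using hwf.induction with
  | _ v ih =>
    have e : vt K s r v.1 = uu K s r F v.1 +
        ∑ f ∈ F.filter (fun f => s f = v.1), ed K s r f * gh K s r f := by
      rw [uu]; simp
    rw [e]
    refine add_mem ?_ (sum_mem fun f hf => ?_)
    · exact Submodule.subset_span ⟨v.1, v.2, [], [], ⟨trivial, by simp⟩, ⟨trivial, by simp⟩,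
        rfl, rfl, by simp [mu, pe_nil, pg_nil]⟩
    · obtain ⟨hfF, hfs⟩ := Finset.mem_filter.1 hf
      have := ih ⟨r f, hW f hfF⟩ (.single ⟨f, hfs, rfl⟩)
      have := SS_mul_gh K s r F hfF (ed_mul_SS K s r F hfF this)
      rw [ed_mul_vt] at this
      rwa [hfs] at this

lemma exists_finite {a : LPAAmbient K V E s r} (h : a ∈ LeavittPathAlgebraNU K V E s r) :
    ∃ (F : Finset E) (W : Finset V), a ∈ NonUnitalAlgebra.adjoin K
      (vt K s r '' W ∪ ed K s r '' F ∪ gh K s r '' F) := by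
  classical
  have mono : ∀ (F F' : Finset E) (W W' : Finset V), F ⊆ F' → W ⊆ W' →
      NonUnitalAlgebra.adjoin K (vt K s r '' W ∪ ed K s r '' F ∪ gh K s r '' F) ≤
      NonUnitalAlgebra.adjoin K (vt K s r '' W' ∪ ed K s r '' F' ∪ gh K s r '' F') := by
    intro F F' W W' h1 h2
    apply NonUnitalAlgebra.adjoin_mono
    gcongr
  induction h using NonUnitalAlgebra.adjoin_induction with
  | mem x hx =>
    obtain ⟨g, rfl⟩ := hx
    cases g with
    | vertex v => exact ⟨∅, {v}, NonUnitalAlgebra.subset_adjoin K (by simp [vt])⟩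
    | edge e => exact ⟨{e}, ∅, NonUnitalAlgebra.subset_adjoin K (by simp [ed])⟩
    | ghost e => exact ⟨{e}, ∅, NonUnitalAlgebra.subset_adjoin K (by simp [gh])⟩
  | zero => exact ⟨∅, ∅, zero_mem _⟩
  | add x y _ _ hx hy =>
    obtain ⟨F, W, hx⟩ := hx
    obtain ⟨F', W', hy⟩ := hy
    exact ⟨F ∪ F', W ∪ W', add_mem
      (mono _ _ _ _ Finset.subset_union_left Finset.subset_union_left hx)
      (mono _ _ _ _ Finset.subset_union_right Finset.subset_union_right hy)⟩
  | mul x y _ _ hx hy =>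
    obtain ⟨F, W, hx⟩ := hx
    obtain ⟨F', W', hy⟩ := hy
    exact ⟨F ∪ F', W ∪ W', mul_mem
      (mono _ _ _ _ Finset.subset_union_left Finset.subset_union_left hx)
      (mono _ _ _ _ Finset.subset_union_right Finset.subset_union_right hy)⟩
  | smul c x _ hx =>
    obtain ⟨F, W, hx⟩ := hx
    exact ⟨F, W, SMulMemClass.smul_mem c hx⟩

lemma mu_mem (w : V) (p q : List E) : mu K s r F w p q ∈ LeavittPathAlgebraNU K V E s r := by
  have hg : ∀ g, lpaGen K s r g ∈ LeavittPathAlgebraNU K V E s r :=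
    fun g => NonUnitalAlgebra.subset_adjoin K ⟨g, rfl⟩
  have hu : uu K s r F w ∈ LeavittPathAlgebraNU K V E s r :=
    sub_mem (hg _) (sum_mem fun f _ => mul_mem (hg _) (hg _))
  have h1 : pe K s r p * uu K s r F w ∈ LeavittPathAlgebraNU K V E s r := by
    induction p with
    | nil => rwa [pe_nil, one_mul]
    | cons e l ih => rw [pe_cons, mul_assoc]; exact mul_mem (hg _) ih
  rw [mu]
  induction q with
  | nil => rwa [pg_nil, mul_one]
  | cons e l ih => rw [pg_cons, ← mul_assoc]; exact mul_mem ih (hg _)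

lemma main_acyc (ha : ¬ ∃ es, IsCycle s r es) (a : LeavittPathAlgebraNU K V E s r) :
    ∃ (R : Type) (_ : Ring R) (_ : Algebra K R) (_ : FiniteDimensional K R)
      (ψ : R →ₙₐ[K] LeavittPathAlgebraNU K V E s r),
      (∀ x : R, ∃ y, x = x * y * x) ∧ ∃ x, ψ x = a := by
  classical
  obtain ⟨F, W₀, hA⟩ := exists_finite K s r a.2
  let W := W₀ ∪ F.image s ∪ F.image r
  have hW0 : ∀ w ∈ W₀, w ∈ W := fun w hw => by simp [W, hw]
  have hWr : ∀ f ∈ F, r f ∈ W := fun f hf => by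
    simp only [W, Finset.mem_union, Finset.mem_image]; exact Or.inr ⟨f, hf, rfl⟩
  let P : W → Type := fun w => {l : List E // Pth s r w.1 l ∧ ∀ e ∈ l, e ∈ F}
  have hP : ∀ w, Finite (P w) := fun w => finite_paths ha F w.1
  have : ∀ w, Fintype (P w) := fun w => Fintype.ofFinite _
  obtain ⟨ψ, hψ⟩ := exists_hom (K := K) P (fun w p q => mu K s r F w.1 p.1 q.1)
    (by
      intro w p q q'
      have := mid_eq K s r F q.2.1
      simp only [mu, mul_assoc]
      rw [← mul_assoc (pe K s r q.1), ← mul_assoc (pg K s r q.1), ← mul_assoc (uu K s r F w.1), this])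
    (by
      intro w p q p' q' hne
      have := mid_ne K s r F q.2.1 p'.2.1 q.2.2 p'.2.2 (.inr fun h => hne (Subtype.ext h))
      simp only [mu, mul_assoc]
      rw [← mul_assoc (pe K s r p'.1), ← mul_assoc (pg K s r q.1), ← mul_assoc (uu K s r F w.1), this,
        zero_mul, mul_zero])
    (by
      intro w w' p q p' q' hne
      have := mid_ne K s r F q.2.1 p'.2.1 q.2.2 p'.2.2 (.inl fun h => hne (Subtype.ext h))
      simp only [mu, mul_assoc]
      rw [← mul_assoc (pe K s r p'.1), ← mul_assoc (pg K s r q.1), ← mul_assoc (uu K s r F w.1), this,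
        zero_mul, mul_zero])
  have hrange : ∀ v v', SS K s r F W v v' ≤ (NonUnitalAlgHom.range ψ).toSubmodule := by
    intro v v'
    rw [SS, Submodule.span_le]
    rintro x ⟨w, hw, p, q, hp, hq, -, -, rfl⟩
    refine ⟨Pi.single ⟨w, hw⟩ (Matrix.single (⟨p, hp⟩ : P ⟨w, hw⟩) (⟨q, hq⟩ : P ⟨w, hw⟩) 1), ?_⟩
    change ψ _ = _
    rw [hψ, Finset.sum_eq_single ⟨w, hw⟩, Finset.sum_eq_single ⟨p, hp⟩,
      Finset.sum_eq_single ⟨q, hq⟩]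
    · simp
    · intro q' _ hq'
      simp [Matrix.single_apply, hq'.symm]
    · simp
    · intro p' _ hp'
      simp [Matrix.single_apply, hp'.symm]
    · simp
    · intro w' _ hw'
      simp [Pi.single_eq_of_ne hw']
    · simp
  have hmem : ∀ M, ψ M ∈ LeavittPathAlgebraNU K V E s r := by
    intro M
    rw [hψ]
    exact sum_mem fun i _ => sum_mem fun p _ => sum_mem fun q _ =>
      SMulMemClass.smul_mem _ (mu_mem K s r F _ _ _)
  have hle : NonUnitalAlgebra.adjoin K (vt K s r '' W₀ ∪ ed K s r '' F ∪ gh K s r '' F) ≤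
      NonUnitalAlgHom.range ψ := by
    apply NonUnitalAlgebra.adjoin_le
    rintro x ((⟨w, hw, rfl⟩ | ⟨f, hf, rfl⟩) | ⟨f, hf, rfl⟩)
    · exact hrange _ _ (vt_mem_SS K s r F ha hWr (hW0 w hw))
    · have := ed_mul_SS K s r F hf (vt_mem_SS K s r F ha hWr (hWr f hf))
      rw [ed_mul_vt] at this
      exact hrange _ _ this
    · have := SS_mul_gh K s r F hf (vt_mem_SS K s r F ha hWr (hWr f hf))
      rw [vt_mul_gh] at this
      exact hrange _ _ this
  refine ⟨∀ w, Matrix (P w) (P w) K, inferInstance, inferInstance, inferInstance,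
    NonUnitalAlgHom.codRestrict ψ _ hmem, ?_, ?_⟩
  · intro M
    choose N hN using fun w => matrix_regular (M w)
    exact ⟨N, funext hN⟩
  · obtain ⟨M, hM⟩ := hle hA
    exact ⟨M, Subtype.ext hM⟩

end acyc

lemma pow₁_eq {R : Type*} [Monoid R] (x : R) (n : ℕ) : pow₁ x n = x ^ (n + 1) := by
  induction n with
  | zero => simp [pow₁]
  | succ n ih => rw [pow₁, ih, ← pow_succ]

lemma map_pow₁ {R S F : Type*} [Mul R] [Mul S] [FunLike F R S] [MulHomClass F R S] (f : F)
    (x : R) (n : ℕ) : f (pow₁ x n) = pow₁ (f x) n := by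
  induction n with
  | zero => rfl
  | succ n ih => rw [pow₁, pow₁, map_mul, ih]

lemma coe_pow₁ {K : Type} [Field K] {V E : Type} {s r : E → V}
    (x : LeavittPathAlgebraNU K V E s r) (n : ℕ) :
    ((pow₁ x n : LeavittPathAlgebraNU K V E s r) : LPAAmbient K V E s r) =
      (x : LPAAmbient K V E s r) ^ (n + 1) := by
  rw [← pow₁_eq]
  induction n with
  | zero => rfl
  | succ n ih => rw [pow₁, pow₁, ← ih]; rfl

end LPA

/-- For an arbitrary directed graph `E` and field `K`, the following are
equivalent for the Leavitt path algebra `L = L_K(E)`: (a) `E` is acyclic; (b) `L` is von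
Neumann regular; (c) `L` is `π`-regular; (d) `L` is strongly left `π`-regular;
(e) `L` is strongly right `π`-regular.  (Here `pow₁ a n = a^(n+1)`, so `n`-th powers with
`n ≥ 1` are exactly the values of `pow₁`.) -/
theorem lpa_acyclic_iff_vonNeumannRegular (K V E : Type) [Field K] (s r : E → V) :
    List.TFAE
      [ ¬ ∃ es : List E, IsCycle s r es,
        ∀ a : LeavittPathAlgebraNU K V E s r, ∃ b, a = a * b * a,
        ∀ a : LeavittPathAlgebraNU K V E s r,
          ∃ (b : LeavittPathAlgebraNU K V E s r) (n : ℕ),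
            pow₁ a n = pow₁ a n * b * pow₁ a n,
        ∀ a : LeavittPathAlgebraNU K V E s r,
          ∃ (b : LeavittPathAlgebraNU K V E s r) (n : ℕ),
            pow₁ a n = b * pow₁ a (n + 1),
        ∀ a : LeavittPathAlgebraNU K V E s r,
          ∃ (b : LeavittPathAlgebraNU K V E s r) (n : ℕ),
            pow₁ a n = pow₁ a (n + 1) * b ] := by
  classical
  have pos : (¬ ∃ es : List E, IsCycle s r es) → ∀ a : LeavittPathAlgebraNU K V E s r,
      (∃ b, a = a * b * a) ∧ ∃ (b : LeavittPathAlgebraNU K V E s r) (n : ℕ),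
        pow₁ a n = b * pow₁ a (n + 1) ∧ pow₁ a n = pow₁ a (n + 1) * b := by
    intro ha a
    obtain ⟨R, _, _, _, ψ, hreg, x, rfl⟩ := LPA.main_acyc K s r ha a
    constructor
    · obtain ⟨y, hy⟩ := hreg x
      exact ⟨ψ y, by rw [← map_mul, ← map_mul, ← hy]⟩
    · obtain ⟨y, n, h1, h2⟩ := LPA.strongly_pi (K := K) x
      refine ⟨ψ y, n, ?_, ?_⟩
      · rw [← LPA.map_pow₁, ← LPA.map_pow₁, ← map_mul, LPA.pow₁_eq, LPA.pow₁_eq, ← h1]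
      · rw [← LPA.map_pow₁, ← LPA.map_pow₁, ← map_mul, LPA.pow₁_eq, LPA.pow₁_eq, ← h2]
  tfae_have 1 → 2 := fun ha a => (pos ha a).1
  tfae_have 1 → 4 := fun ha a => by
    obtain ⟨b, n, h, -⟩ := (pos ha a).2
    exact ⟨b, n, h⟩
  tfae_have 1 → 5 := fun ha a => by
    obtain ⟨b, n, -, h⟩ := (pos ha a).2
    exact ⟨b, n, h⟩
  tfae_have 2 → 3 := fun h a => by
    obtain ⟨b, hb⟩ := h a
    exact ⟨b, 0, hb⟩
  tfae_have 3 → 1 := by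
    rintro h ⟨es, hes⟩
    obtain ⟨a, h1, -, -⟩ := LPA.main_cyc K s r hes
    obtain ⟨b, n, hb⟩ := h a
    apply h1 b n
    have := congrArg Subtype.val hb
    simpa only [NonUnitalSubalgebra.coe_mul, LPA.coe_pow₁] using this
  tfae_have 4 → 1 := by
    rintro h ⟨es, hes⟩
    obtain ⟨a, -, h1, -⟩ := LPA.main_cyc K s r hes
    obtain ⟨b, n, hb⟩ := h a
    apply h1 b n
    have := congrArg Subtype.val hb
    simpa only [NonUnitalSubalgebra.coe_mul, LPA.coe_pow₁] using this
  tfae_have 5 → 1 := by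
    rintro h ⟨es, hes⟩
    obtain ⟨a, -, -, h1⟩ := LPA.main_cyc K s r hes
    obtain ⟨b, n, hb⟩ := h a
    apply h1 b n
    have := congrArg Subtype.val hb
    simpa only [NonUnitalSubalgebra.coe_mul, LPA.coe_pow₁] using this
  tfae_finish
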